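/- For every real number β ∈ [0,1] there exists a sequence of elements g_n ∈ A_n (the alternating group on n letters) such that log|g_n^{A_n}| / log|A_n| → β as n → ∞, where g_n^{A_n} denotes the conjugacy class of g_n in A_n and |·| denotes cardinality. -/

import Mathlib

/-- The conjugacy class of `g` in its group, as a set. -/
def conjClass {G : Type*} [Group G] (g : G) : Set G := {x | ∃ h : G, x = h⁻¹ * g * h}

open Equiv Equiv.Perm Nat in
/-- Size of an `A_n`-class up to a factor of two, in terms of the centralizer in `S_n`. -/
lemma conjClass_bounds (n : ℕ) (hn : 2 ≤ n) (g : ↥(alternatingGroup (Fin n))) :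
    n ! ≤ 2 * Nat.card ↥(conjClass g) *
        Nat.card (Subgroup.centralizer {(g : Perm (Fin n))}) ∧
      Nat.card ↥(conjClass g) *
        Nat.card (Subgroup.centralizer {(g : Perm (Fin n))}) ≤ n ! := by
  classical
  have : Nontrivial (Fin n) := Fin.nontrivial_iff_two_le.mpr hn
  have hA : 2 * Nat.card (alternatingGroup (Fin n)) = n ! := by
    rw [two_mul_nat_card_alternatingGroup, Nat.card_perm, Nat.card_eq_fintype_card,
      Fintype.card_fin]
  constructor
  · have h1 : Nat.card ↥(conjClass g) * Nat.card (Subgroup.centralizer {g})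
        = Nat.card (alternatingGroup (Fin n)) := by
      have he : conjClass g = MulAction.orbit (ConjAct (alternatingGroup (Fin n))) g := by
        ext h
        rw [ConjAct.mem_orbit_conjAct, isConj_comm, isConj_iff]
        constructor
        · rintro ⟨c, rfl⟩
          exact ⟨c⁻¹, by simp⟩
        · rintro ⟨c, rfl⟩
          exact ⟨c⁻¹, by simp⟩
      rw [he, Subgroup.nat_card_centralizer_nat_card_stabilizer, ← Nat.card_prod]
      exact Nat.card_congr (MulAction.orbitProdStabilizerEquivGroup
        (ConjAct (alternatingGroup (Fin n))) g)
    have h2 : Nat.card (Subgroup.centralizer {g}) ≤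
        Nat.card (Subgroup.centralizer {(g : Perm (Fin n))}) := by
      refine Nat.card_le_card_of_injective
        (fun x => ⟨((x : alternatingGroup (Fin n)) : Perm (Fin n)), ?_⟩) ?_
      · have := Subgroup.mem_centralizer_singleton_iff.mp x.2
        rw [Subgroup.mem_centralizer_singleton_iff]
        exact congrArg Subtype.val this
      · intro x y h
        exact Subtype.ext (Subtype.ext (Subtype.mk.inj h))
    rw [← hA, ← h1, mul_assoc]
    gcongr
  · have h1 : Nat.card ↥(conjClass g) ≤
        Nat.card {h : Perm (Fin n) | IsConj (g : Perm (Fin n)) h} := by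
      refine Nat.card_le_card_of_injective (fun x => ⟨((x : alternatingGroup (Fin n)) :
        Perm (Fin n)), ?_⟩) ?_
      · obtain ⟨c, hc⟩ := x.2
        change IsConj _ _
        rw [isConj_iff]
        exact ⟨(c : Perm (Fin n))⁻¹, by rw [hc]; simp⟩
      · intro x y h
        exact Subtype.ext (Subtype.ext (Subtype.mk.inj h))
    have h2 := card_isConj_mul_eq (g : Perm (Fin n))
    rw [← nat_card_centralizer, Fintype.card_fin] at h2
    rw [← h2]
    gcongr

open Equiv Equiv.Perm Nat in
lemma exists_good (n k : ℕ) (hn : 2 ≤ n) (hk : Odd k) (hkn : k ≤ n) :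
    ∃ g : ↥(alternatingGroup (Fin n)),
      n ! ≤ 2 * Nat.card ↥(conjClass g) * ((n - k)! * n) ∧
      Nat.card ↥(conjClass g) * (n - k)! ≤ n ! := by
  classical
  rcases Nat.lt_or_ge k 2 with h | h
  · have hk1 : k = 1 := by
      rcases hk with ⟨j, hj⟩
      omega
    subst hk1
    refine ⟨1, ?_⟩
    have : conjClass (1 : ↥(alternatingGroup (Fin n))) = {1} := by
      ext x
      simp [conjClass]
    rw [this]
    have hc : Nat.card ({1} : Set ↥(alternatingGroup (Fin n))) = 1 := by simp
    rw [hc, mul_comm ((n - 1)!) n, Nat.mul_factorial_pred (by omega)]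
    refine ⟨by omega, ?_⟩
    rw [one_mul]
    exact Nat.factorial_le (by omega)
  · obtain ⟨g, hg⟩ := (exists_with_cycleType_iff (Fin n) (m := {k})).mpr
      ⟨by simpa using hkn, by simpa using h⟩
    have hs : g ∈ alternatingGroup (Fin n) := by
      rw [Equiv.Perm.mem_alternatingGroup, sign_of_cycleType, hg]
      simp only [Multiset.sum_singleton, Multiset.card_singleton]
      exact (hk.add_odd odd_one).neg_one_pow
    refine ⟨⟨g, hs⟩, ?_⟩
    have hb := conjClass_bounds n hn ⟨g, hs⟩
    have hz : Nat.card (Subgroup.centralizer {g}) = (n - k)! * k := by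
      rw [nat_card_centralizer, hg]
      simp
    simp only [hz] at hb
    refine ⟨hb.1.trans ?_, le_trans ?_ hb.2⟩
    · gcongr
    · gcongr
      exact Nat.le_mul_of_pos_right _ (by omega)

lemma log_factorial_lower (n r : ℕ) (hn : 0 < n) :
    (r : ℝ) * Real.log n - n ≤ Real.log (r.factorial : ℝ) := by
  have hn' : (0 : ℝ) < n := by exact_mod_cast hn
  have hr : (0 : ℝ) < (r.factorial : ℝ) := by exact_mod_cast r.factorial_pos
  have h := Real.pow_div_factorial_le_exp (n : ℝ) hn'.le r
  have h2 := Real.log_le_log (by positivity) h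
  rw [Real.log_exp, Real.log_div (by positivity) (by positivity), Real.log_pow] at h2
  linarith

lemma log_factorial_upper (n r : ℕ) (hr : r ≤ n) :
    Real.log (r.factorial : ℝ) ≤ (r : ℝ) * Real.log n := by
  have h : r.factorial ≤ n ^ r := (Nat.factorial_le_pow r).trans (Nat.pow_le_pow_left hr r)
  rw [← Real.log_pow]
  refine Real.log_le_log (by exact_mod_cast r.factorial_pos) ?_
  exact_mod_cast h

open Filter Topology in
lemma log_factorial_ratio (r : ℕ → ℕ) (c : ℝ) (hr : ∀ᶠ n in atTop, r n ≤ n)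
    (hc : Tendsto (fun n => (r n : ℝ) / n) atTop (𝓝 c)) :
    Tendsto (fun n : ℕ => Real.log ((r n).factorial : ℝ) / (n * Real.log n)) atTop (𝓝 c) := by
  have hlog : Tendsto (fun n : ℕ => Real.log (n : ℝ)) atTop atTop :=
    Real.tendsto_log_atTop.comp tendsto_natCast_atTop_atTop
  have hl : Tendsto (fun n : ℕ => (r n : ℝ) / n - (Real.log (n : ℝ))⁻¹) atTop (𝓝 c) := by
    simpa using hc.sub hlog.inv_tendsto_atTop
  refine tendsto_of_tendsto_of_tendsto_of_le_of_le' hl hc ?_ ?_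
  · filter_upwards [eventually_ge_atTop 2] with n hn
    have h1 : (0 : ℝ) < n := by positivity
    have h2 : 0 < Real.log (n : ℝ) := Real.log_pos (by exact_mod_cast hn)
    rw [le_div_iff₀ (by positivity)]
    refine le_trans (le_of_eq ?_) (log_factorial_lower n (r n) (by omega))
    field_simp
  · filter_upwards [eventually_ge_atTop 2, hr] with n hn hrn
    have h1 : (0 : ℝ) < n := by positivity
    have h2 : 0 < Real.log (n : ℝ) := Real.log_pos (by exact_mod_cast hn)
    rw [div_le_iff₀ (by positivity)]
    refine (log_factorial_upper n (r n) hrn).trans (le_of_eq ?_)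
    field_simp

open Filter Topology in
/-- For every `β ∈ [0,1]` there are elements `g_n ∈ A_n` with
`log|g_n^{A_n}|/log|A_n| → β` as `n → ∞`. -/
theorem exists_alternating_class_ratio_tendsto
    (β : ℝ) (hβ : β ∈ Set.Icc (0 : ℝ) 1) :
    ∃ g : (n : ℕ) → ↥(alternatingGroup (Fin n)),
      Filter.Tendsto
        (fun n => Real.log (Nat.card ↥(conjClass (g n))) /
          Real.log (Nat.card ↥(alternatingGroup (Fin n))))
        Filter.atTop (nhds β) := by
  obtain ⟨hβ0, hβ1⟩ := hβ
  set k : ℕ → ℕ := fun n => 2 * ⌊β * ((n : ℝ) - 1) / 2⌋₊ + 1 with hk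
  have hkodd : ∀ n, Odd (k n) := fun n => ⟨_, rfl⟩
  have hfl : ∀ n : ℕ, 2 ≤ n → ((k n : ℝ) ≤ β * n + 1 ∧ β * n - 2 ≤ k n ∧ k n ≤ n) := by
    intro n hn
    have hn' : (2 : ℝ) ≤ n := by exact_mod_cast hn
    have h0 : 0 ≤ β * ((n : ℝ) - 1) / 2 := by
      have : 0 ≤ β * ((n : ℝ) - 1) := mul_nonneg hβ0 (by linarith)
      linarith
    have h1 := Nat.floor_le h0
    have h2 := Nat.lt_floor_add_one (β * ((n : ℝ) - 1) / 2)
    have hkc : (k n : ℝ) = 2 * (⌊β * ((n : ℝ) - 1) / 2⌋₊ : ℝ) + 1 := by simp [hk]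
    refine ⟨by linarith, by linarith, ?_⟩
    have : (k n : ℝ) ≤ n := by nlinarith
    exact_mod_cast this
  have hex : ∀ n, ∃ g : ↥(alternatingGroup (Fin n)), 2 ≤ n →
      n.factorial ≤ 2 * Nat.card ↥(conjClass g) * ((n - k n).factorial * n) ∧
      Nat.card ↥(conjClass g) * (n - k n).factorial ≤ n.factorial := by
    intro n
    by_cases hn : 2 ≤ n
    · obtain ⟨g, hg⟩ := exists_good n (k n) hn (hkodd n) (hfl n hn).2.2
      exact ⟨g, fun _ => hg⟩
    · exact ⟨1, fun h => absurd h hn⟩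
  choose g hg using hex
  refine ⟨g, ?_⟩

  have hlog : Tendsto (fun n : ℕ => Real.log (n : ℝ)) atTop atTop :=
    Real.tendsto_log_atTop.comp tendsto_natCast_atTop_atTop
  have hinvn : Tendsto (fun n : ℕ => ((n : ℝ))⁻¹) atTop (𝓝 0) :=
    tendsto_inv_atTop_nhds_zero_nat
  have hinvl : Tendsto (fun n : ℕ => (Real.log (n : ℝ))⁻¹) atTop (𝓝 0) :=
    hlog.inv_tendsto_atTop
  have hk1 : Tendsto (fun n : ℕ => (k n : ℝ) / n) atTop (𝓝 β) := by
    have hl : Tendsto (fun n : ℕ => β - 2 * ((n : ℝ))⁻¹) atTop (𝓝 β) := by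
      simpa using tendsto_const_nhds.sub (hinvn.const_mul 2)
    have hu : Tendsto (fun n : ℕ => β + ((n : ℝ))⁻¹) atTop (𝓝 β) := by
      simpa using tendsto_const_nhds.add hinvn
    refine tendsto_of_tendsto_of_tendsto_of_le_of_le' hl hu ?_ ?_
    · filter_upwards [eventually_ge_atTop 2] with n hn
      have h1 : (0 : ℝ) < n := by positivity
      rw [le_div_iff₀ h1]
      refine le_trans (le_of_eq ?_) (hfl n hn).2.1
      field_simp
    · filter_upwards [eventually_ge_atTop 2] with n hn
      have h1 : (0 : ℝ) < n := by positivity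
      rw [div_le_iff₀ h1]
      refine (hfl n hn).1.trans (le_of_eq ?_)
      field_simp
  have hr1 : Tendsto (fun n : ℕ => ((n - k n : ℕ) : ℝ) / n) atTop (𝓝 (1 - β)) := by
    refine (tendsto_const_nhds.sub hk1).congr' ?_
    filter_upwards [eventually_ge_atTop 2] with n hn
    have h1 : (0 : ℝ) < n := by positivity
    rw [Nat.cast_sub (hfl n hn).2.2]
    field_simp
  have hF := log_factorial_ratio (fun n => n - k n) (1 - β)
    (Eventually.of_forall fun n => Nat.sub_le _ _) hr1
  have hN := log_factorial_ratio (fun n => n) 1 (Eventually.of_forall fun n => le_rfl) (by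
    refine tendsto_const_nhds.congr' ?_
    filter_upwards [eventually_ge_atTop 2] with n hn
    have h1 : (0 : ℝ) < n := by positivity
    field_simp)
  have hinvnl : Tendsto (fun n : ℕ => Real.log 2 * ((n : ℝ)⁻¹ * (Real.log (n : ℝ))⁻¹))
      atTop (𝓝 0) := by
    simpa using (hinvn.mul hinvl).const_mul (Real.log 2)
  have hD : Tendsto (fun n : ℕ => Real.log (Nat.card ↥(alternatingGroup (Fin n))) /
      (n * Real.log n)) atTop (𝓝 1) := by
    have := hN.sub hinvnl
    rw [sub_zero] at this
    refine this.congr' ?_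
    filter_upwards [eventually_ge_atTop 2] with n hn
    have : Nontrivial (Fin n) := Fin.nontrivial_iff_two_le.mpr hn
    have hA : 2 * Nat.card (alternatingGroup (Fin n)) = n.factorial := by
      rw [two_mul_nat_card_alternatingGroup, Nat.card_perm, Nat.card_eq_fintype_card,
        Fintype.card_fin]
    have hpos : (0 : ℝ) < Nat.card (alternatingGroup (Fin n)) := by
      exact_mod_cast Nat.card_pos
    rw [← hA]
    push_cast
    rw [Real.log_mul (by norm_num) hpos.ne', ← mul_inv, ← div_eq_mul_inv, ← sub_div]
    congr 1
    ring
  have hC : Tendsto (fun n : ℕ => Real.log (Nat.card ↥(conjClass (g n))) /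
      (n * Real.log n)) atTop (𝓝 β) := by
    have hu := hN.sub hF
    have hl := (hu.sub hinvnl).sub hinvn
    have e : (1 : ℝ) - (1 - β) = β := by ring
    rw [e] at hu hl
    rw [sub_zero, sub_zero] at hl
    refine tendsto_of_tendsto_of_tendsto_of_le_of_le' hl hu ?_ ?_
    all_goals
      filter_upwards [eventually_ge_atTop 2] with n hn
      have h1 : (0 : ℝ) < n := by positivity
      have h2 : 0 < Real.log (n : ℝ) := Real.log_pos (by exact_mod_cast hn)
      have hf : (0 : ℝ) < ((n - k n).factorial : ℝ) := by exact_mod_cast Nat.factorial_pos _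
      have hf' : (0 : ℝ) < (n.factorial : ℝ) := by exact_mod_cast Nat.factorial_pos _
      have hc : (0 : ℝ) < Nat.card ↥(conjClass (g n)) := by
        have : Nonempty ↥(conjClass (g n)) := ⟨⟨g n, 1, by simp⟩⟩
        exact_mod_cast Nat.card_pos
      obtain ⟨ha, hb⟩ := hg n hn
    · rw [le_div_iff₀ (by positivity)]
      have ha' : (n.factorial : ℝ) ≤ 2 * Nat.card ↥(conjClass (g n)) *
        ((n - k n).factorial * n) := by exact_mod_cast ha
      have := Real.log_le_log hf' ha'
      rw [Real.log_mul (by positivity) (by positivity), Real.log_mul (by norm_num) hc.ne',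
        Real.log_mul hf.ne' h1.ne'] at this
      refine le_trans (le_of_eq ?_) (sub_le_iff_le_add.mpr (this.trans (le_of_eq
        (show _ = Real.log (Nat.card ↥(conjClass (g n))) + (Real.log 2 +
          Real.log ((n - k n).factorial : ℝ) + Real.log n) by ring))))
      field_simp
      ring
    · rw [← sub_div]
      gcongr
      have hb' : (Nat.card ↥(conjClass (g n)) : ℝ) * (n - k n).factorial ≤ n.factorial := by
        exact_mod_cast hb
      have := Real.log_le_log (by positivity) hb'
      rw [Real.log_mul hc.ne' hf.ne'] at this
      linarith
  have := hC.div hD one_ne_zero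
  rw [div_one] at this
  refine this.congr' ?_
  filter_upwards [eventually_ge_atTop 2] with n hn
  have h1 : (0 : ℝ) < n := by positivity
  have h2 : 0 < Real.log (n : ℝ) := Real.log_pos (by exact_mod_cast hn)
  exact div_div_div_cancel_right₀ (by positivity) _ _
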